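/- Let P ⊂ ℝ⁴ be a 4-dimensional reflexive polytope, and suppose L_P has a root −1/2 + a + bi ∈ ℂ with a ≠ 0 and b ≠ 0. Then |a| < 3/2; consequently every root z of L_P satisfies −2 ≤ Re z ≤ 1. -/

import Mathlib

open Pointwise MeasureTheory Polynomial

noncomputable section

/-- The lattice points of a subset `S ⊆ ℝ^d`: integer vectors whose real cast lies in `S`. -/
def latticePts (d : ℕ) (S : Set (Fin d → ℝ)) : Set (Fin d → ℤ) :=
  {x | (fun i => (x i : ℝ)) ∈ S}

/-- `P ⊆ ℝ^d` is a lattice polytope: the convex hull of finitely many integer points. -/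
def IsLatticePolytope (d : ℕ) (P : Set (Fin d → ℝ)) : Prop :=
  ∃ V : Finset (Fin d → ℤ),
    P = convexHull ℝ ((fun v : Fin d → ℤ => fun i => (v i : ℝ)) '' (V : Set (Fin d → ℤ)))

/-- `P` is full-dimensional in `ℝ^d`. -/
def IsFullDim (d : ℕ) (P : Set (Fin d → ℝ)) : Prop :=
  affineSpan ℝ P = ⊤

/-- `L` is the Ehrhart polynomial of `P`: `L(m) = |mP ∩ ℤ^d|` for every natural number `m`. -/
def IsEhrhart (d : ℕ) (P : Set (Fin d → ℝ)) (L : Polynomial ℚ) : Prop :=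
  ∀ m : ℕ, L.eval (m : ℚ) = ((latticePts d ((m : ℝ) • P)).ncard : ℚ)

/-- The complex roots of a rational polynomial, counted with multiplicity. -/
def cRoots (L : Polynomial ℚ) : Multiset ℂ :=
  (L.map (algebraMap ℚ ℂ)).roots

/-- `L` is a CL-polynomial: every complex root has real part `-1/2`. -/
def IsCL (L : Polynomial ℚ) : Prop :=
  ∀ z ∈ cRoots L, z.re = -(1/2 : ℝ)

/-- `L` has only real roots: every complex root has imaginary part `0`. -/
def IsRealRooted (L : Polynomial ℚ) : Prop :=
  ∀ z ∈ cRoots L, z.im = 0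

/-- The dual (polar) body `{u : ⟨u,v⟩ ≥ -1 for all v ∈ P}`. -/
def dualBody (d : ℕ) (P : Set (Fin d → ℝ)) : Set (Fin d → ℝ) :=
  {u | ∀ v ∈ P, -1 ≤ ∑ i, u i * v i}

/-- `P` is reflexive: the origin is interior and the dual body is a lattice polytope. -/
def IsReflexive (d : ℕ) (P : Set (Fin d → ℝ)) : Prop :=
  (0 : Fin d → ℝ) ∈ interior P ∧ IsLatticePolytope d (dualBody d P)

/-- The Euclidean volume of `P ⊆ ℝ^d`. -/
def vol (d : ℕ) (P : Set (Fin d → ℝ)) : ℝ :=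
  (volume P).toReal

/-- `δ` is the δ-vector of the Ehrhart polynomial `L` in dimension `d`:
`L(m) = ∑_{j=0}^d δ_j C(d+m-j, d)` for all natural numbers `m`. -/
def HasDeltaVector (d : ℕ) (L : Polynomial ℚ) (δ : Fin (d+1) → ℤ) : Prop :=
  ∀ m : ℕ, L.eval (m : ℚ) = ∑ j : Fin (d+1), (δ j : ℚ) * (Nat.choose (d + m - (j : ℕ)) d : ℚ)

/-- The discriminant `B²C² − 4AC³ − 4B³D − 27A²D² + 18ABCD` of the cubic `Az³+Bz²+Cz+D`. -/
def cubicDisc (A B C D : ℚ) : ℚ :=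
  B^2*C^2 - 4*A*C^3 - 4*B^3*D - 27*A^2*D^2 + 18*A*B*C*D

/-- The data on which the Euler characteristic is computed: a bounded convex set that is either
compact, with sign `1`, or open, with sign `(-1) ^ k`. -/
def HasEulerSign (k : ℕ) (K : Set (Fin k → ℝ)) (σ : ℤ) : Prop :=
  Convex ℝ K ∧ ((IsCompact K ∧ σ = 1) ∨
    (IsOpen K ∧ (∃ C, IsCompact C ∧ K ⊆ C) ∧ σ = (-1) ^ k))

/-- Right-hand jumps of the indicator of a bounded interval add up to its Euler characteristic. -/
lemma exists_endpoints_sum_jump {K : Set ℝ} {σ : ℤ} (hK : K.Nonempty) (hc : Convex ℝ K)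
    (h : (IsCompact K ∧ σ = 1) ∨ (IsOpen K ∧ (∃ C, IsCompact C ∧ K ⊆ C) ∧ σ = -1)) :
    ∃ T₀ : Finset ℝ, ∀ T : Finset ℝ, T₀ ⊆ T → ∀ᶠ ε in nhdsWithin (0 : ℝ) (Set.Ioi 0),
      ∑ t ∈ T, (K.indicator (1 : ℝ → ℤ) t - K.indicator 1 (t + ε)) = σ := by
  classical
  have hconn : IsPreconnected K := hc.isPreconnected
  have hbdd : Bornology.IsBounded K := by
    rcases h with ⟨h, -⟩ | ⟨-, ⟨C, hC, hKC⟩, -⟩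
    · exact h.isBounded
    · exact hC.isBounded.subset hKC
  have hbb : BddBelow K := hbdd.bddBelow
  have hba : BddAbove K := hbdd.bddAbove
  set α := sInf K
  set β := sSup K
  have near (t c : ℝ) (htc : t < c) :
      ∀ᶠ ε in nhdsWithin (0 : ℝ) (Set.Ioi 0), t + ε < c := by
    have : Set.Iio (c - t) ∈ nhds (0 : ℝ) := Iio_mem_nhds (by linarith)
    filter_upwards [nhdsWithin_le_nhds this] with ε hε
    simp only [Set.mem_Iio] at hε
    linarith
  rcases h with ⟨h, rfl⟩ | ⟨h, -, rfl⟩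
  · have hKI : K = Set.Icc α β := by
      apply Set.Subset.antisymm
      · exact fun x hx => ⟨csInf_le hbb hx, le_csSup hba hx⟩
      · exact hconn.Icc_subset (h.sInf_mem hK) (h.sSup_mem hK)
    have hαβ : α ≤ β := by
      obtain ⟨x, hx⟩ := hK
      exact (csInf_le hbb hx).trans (le_csSup hba hx)
    refine ⟨{α, β}, fun T hT => ?_⟩
    have key : ∀ t ∈ T, ∀ᶠ ε in nhdsWithin (0 : ℝ) (Set.Ioi 0),
        K.indicator (1 : ℝ → ℤ) t - K.indicator 1 (t + ε) = if t = β then 1 else 0 := by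
      intro t _
      rw [hKI]
      rcases lt_trichotomy t β with h1 | h1 | h1
      · rcases lt_or_ge t α with h2 | h2
        · filter_upwards [near t α h2] with ε hε
          rw [Set.indicator_of_notMem, Set.indicator_of_notMem, if_neg h1.ne, sub_zero]
          · exact fun hh => absurd hh.1 (not_le.2 hε)
          · exact fun hh => absurd hh.1 (not_le.2 h2)
        · filter_upwards [near t β h1, self_mem_nhdsWithin] with ε hε hε0
          simp only [Set.mem_Ioi] at hε0
          rw [Set.indicator_of_mem, Set.indicator_of_mem, if_neg h1.ne]
          · simp
          · exact ⟨by linarith, hε.le⟩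
          · exact ⟨h2, h1.le⟩
      · filter_upwards [self_mem_nhdsWithin] with ε hε0
        simp only [Set.mem_Ioi] at hε0
        rw [Set.indicator_of_mem, Set.indicator_of_notMem, if_pos h1]
        · simp
        · exact fun hh => absurd hh.2 (by linarith)
        · exact ⟨by linarith, h1.le⟩
      · filter_upwards [self_mem_nhdsWithin] with ε hε0
        simp only [Set.mem_Ioi] at hε0
        rw [Set.indicator_of_notMem, Set.indicator_of_notMem, if_neg h1.ne', sub_zero]
        · exact fun hh => absurd hh.2 (by linarith)
        · exact fun hh => absurd hh.2 (by linarith)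
    filter_upwards [(Filter.eventually_all_finset T).2 key] with ε hε
    rw [Finset.sum_congr rfl hε, Finset.sum_ite_eq', if_pos (hT (by simp))]
  · have hKI : K = Set.Ioo α β := by
      apply Set.Subset.antisymm
      · intro x hx
        have hn : K ∈ nhds x := h.mem_nhds hx
        obtain ⟨l, hl, hl'⟩ := (Filter.nonempty_of_mem
          (Filter.inter_mem (nhdsWithin_le_nhds (s := Set.Iio x) hn) self_mem_nhdsWithin))
        obtain ⟨r, hr, hr'⟩ := (Filter.nonempty_of_mem
          (Filter.inter_mem (nhdsWithin_le_nhds (s := Set.Ioi x) hn) self_mem_nhdsWithin))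
        exact ⟨(csInf_le hbb hl).trans_lt hl', lt_of_lt_of_le hr' (le_csSup hba hr)⟩
      · exact IsConnected.Ioo_csInf_csSup_subset ⟨hK, hconn⟩ hbb hba
    have hαβ : α < β := by
      rw [hKI] at hK
      exact Set.nonempty_Ioo.1 hK
    refine ⟨{α, β}, fun T hT => ?_⟩
    have key : ∀ t ∈ T, ∀ᶠ ε in nhdsWithin (0 : ℝ) (Set.Ioi 0),
        K.indicator (1 : ℝ → ℤ) t - K.indicator 1 (t + ε) = if t = α then -1 else 0 := by
      intro t _
      rw [hKI]
      rcases lt_trichotomy t α with h1 | h1 | h1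
      · filter_upwards [near t α h1] with ε hε
        rw [Set.indicator_of_notMem, Set.indicator_of_notMem, if_neg h1.ne, sub_zero]
        · exact fun hh => absurd hh.1 (not_lt.2 hε.le)
        · exact fun hh => absurd hh.1 (not_lt.2 h1.le)
      · filter_upwards [near t β (by linarith), self_mem_nhdsWithin] with ε hε hε0
        simp only [Set.mem_Ioi] at hε0
        rw [Set.indicator_of_notMem, Set.indicator_of_mem, if_pos h1]
        · simp
        · exact ⟨by linarith, hε⟩
        · exact fun hh => absurd hh.1 (by linarith)
      · rcases lt_or_ge t β with h2 | h2
        · filter_upwards [near t β h2, self_mem_nhdsWithin] with ε hε hε0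
          simp only [Set.mem_Ioi] at hε0
          rw [Set.indicator_of_mem, Set.indicator_of_mem, if_neg h1.ne']
          · simp
          · exact ⟨by linarith, hε⟩
          · exact ⟨h1, h2⟩
        · filter_upwards [self_mem_nhdsWithin] with ε hε0
          simp only [Set.mem_Ioi] at hε0
          rw [Set.indicator_of_notMem, Set.indicator_of_notMem, if_neg h1.ne', sub_zero]
          · exact fun hh => absurd hh.2 (by linarith)
          · exact fun hh => absurd hh.2 (by linarith)
    filter_upwards [(Filter.eventually_all_finset T).2 key] with ε hε
    rw [Finset.sum_congr rfl hε, Finset.sum_ite_eq', if_pos (hT (by simp))]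

open Classical in
/-- A linear relation between indicators of bounded intervals, each compact or open, is also
satisfied by their Euler characteristics. -/
lemma sum_eulerSign_eq_zero_line {ι : Type*} (s : Finset ι) (c σ : ι → ℤ) (K : ι → Set ℝ)
    (hc : ∀ i ∈ s, Convex ℝ (K i))
    (h : ∀ i ∈ s, (IsCompact (K i) ∧ σ i = 1) ∨
      (IsOpen (K i) ∧ (∃ C, IsCompact C ∧ K i ⊆ C) ∧ σ i = -1))
    (hsum : ∀ x, ∑ i ∈ s, c i * (K i).indicator 1 x = 0) :
    ∑ i ∈ s, c i * (if (K i).Nonempty then σ i else 0) = 0 := by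
  have hjump : ∀ i ∈ s, ∃ T₀ : Finset ℝ, ∀ T : Finset ℝ, T₀ ⊆ T →
      ∀ᶠ ε in nhdsWithin (0 : ℝ) (Set.Ioi 0),
      ∑ t ∈ T, ((K i).indicator (1 : ℝ → ℤ) t - (K i).indicator 1 (t + ε)) =
        if (K i).Nonempty then σ i else 0 := by
    intro i hi
    by_cases hne : (K i).Nonempty
    · simpa only [if_pos hne] using exists_endpoints_sum_jump hne (hc i hi) (h i hi)
    · refine ⟨∅, fun T _ => Filter.Eventually.of_forall fun ε => ?_⟩
      rw [Set.not_nonempty_iff_eq_empty.1 hne]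
      simp
  choose! T₀ hT₀ using hjump
  have hev : ∀ i ∈ s, _ := fun i hi =>
    hT₀ i hi (s.biUnion T₀) (Finset.subset_biUnion_of_mem T₀ hi)
  obtain ⟨ε, hε⟩ := ((Filter.eventually_all_finset s).2 hev).exists
  rw [← Finset.sum_congr rfl fun i hi => congrArg (c i * ·) (hε i hi)]
  simp only [Finset.mul_sum]
  rw [Finset.sum_comm]
  refine Finset.sum_eq_zero fun t _ => ?_
  simp only [mul_sub, Finset.sum_sub_distrib, hsum, sub_zero]

open Classical in
/-- A linear relation between indicators of bounded convex sets, each compact or open, is also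
satisfied by their Euler characteristics. -/
lemma sum_eulerSign_eq_zero {ι : Type*} (s : Finset ι) (k : ℕ) (c σ : ι → ℤ)
    (K : ι → Set (Fin k → ℝ)) (h : ∀ i ∈ s, HasEulerSign k (K i) (σ i))
    (hsum : ∀ x, ∑ i ∈ s, c i * (K i).indicator 1 x = 0) :
    ∑ i ∈ s, c i * (if (K i).Nonempty then σ i else 0) = 0 := by
  induction k generalizing σ with
  | zero =>
    refine Eq.trans ?_ (hsum default)
    refine Finset.sum_congr rfl fun i hi => ?_
    have hσ : σ i = 1 := by
      rcases (h i hi).2 with ⟨-, h⟩ | ⟨-, -, h⟩ <;> simpa using h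
    by_cases hne : (K i).Nonempty
    · rw [if_pos hne, hσ, Set.indicator_of_mem (by
        obtain ⟨x, hx⟩ := hne
        rwa [Subsingleton.elim default x])]
      rfl
    · rw [if_neg hne, Set.indicator_of_notMem fun hd => hne ⟨_, hd⟩]
  | succ k ih =>
    set τ : ι → ℤ := fun i => if IsCompact (K i) ∧ σ i = 1 then 1 else (-1) ^ k with hτ
    set ρ : ι → ℤ := fun i => if IsCompact (K i) ∧ σ i = 1 then 1 else -1 with hρ
    have hσ : ∀ i ∈ s, σ i = τ i * ρ i := by
      intro i hi
      by_cases hcpt : IsCompact (K i) ∧ σ i = 1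
      · simp [hτ, hρ, hcpt]
      · rcases (h i hi).2 with h' | ⟨-, -, h'⟩
        · exact absurd h' hcpt
        · simp only [hτ, hρ, if_neg hcpt, h', pow_succ]
    have hcons : Continuous fun x : ℝ × (Fin k → ℝ) => (Fin.cons x.1 x.2 : Fin (k + 1) → ℝ) := by
      fun_prop
    have htail : Continuous (Fin.tail : (Fin (k + 1) → ℝ) → Fin k → ℝ) :=
      continuous_pi fun j => continuous_apply _
    have hslice : ∀ t : ℝ, ∀ i ∈ s,
        HasEulerSign k {u | (Fin.cons t u : Fin (k + 1) → ℝ) ∈ K i} (τ i) := by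
      intro t i hi
      have hct : Continuous fun u : Fin k → ℝ => (Fin.cons t u : Fin (k + 1) → ℝ) :=
        hcons.comp (Continuous.prodMk_right t)
      refine ⟨?_, ?_⟩
      · intro u hu w hw p q hp hq hpq
        have := (h i hi).1 hu hw hp hq hpq
        simp only [Set.mem_ofPred]
        convert this using 1
        ext j
        refine Fin.cases ?_ (fun j => ?_) j
        · simp [← add_mul, hpq]
        · simp
      · by_cases hcpt : IsCompact (K i) ∧ σ i = 1
        · refine Or.inl ⟨?_, if_pos hcpt⟩
          refine (hcpt.1.image htail).of_isClosed_subset (hcpt.1.isClosed.preimage hct) ?_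
          exact fun u hu => ⟨_, hu, Fin.tail_cons _ _⟩
        · rcases (h i hi).2 with h' | ⟨ho, ⟨C, hC, hKC⟩, h'⟩
          · exact absurd h' hcpt
          · refine Or.inr ⟨ho.preimage hct, ⟨_, hC.image htail, ?_⟩, if_neg hcpt⟩
            exact fun u hu => ⟨_, hKC hu, Fin.tail_cons _ _⟩
    have himage : ∀ i t, t ∈ (fun x : Fin (k + 1) → ℝ => x 0) '' K i ↔
        ({u | (Fin.cons t u : Fin (k + 1) → ℝ) ∈ K i} : Set (Fin k → ℝ)).Nonempty := by
      intro i t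
      constructor
      · rintro ⟨x, hx, rfl⟩
        exact ⟨Fin.tail x, by simpa using hx⟩
      · rintro ⟨u, hu⟩
        exact ⟨_, hu, rfl⟩
    have hline := sum_eulerSign_eq_zero_line s (fun i => c i * τ i) ρ
      (fun i => (fun x : Fin (k + 1) → ℝ => x 0) '' K i) ?_ ?_ ?_
    · refine Eq.trans ?_ hline
      refine Finset.sum_congr rfl fun i hi => ?_
      simp only [Set.image_nonempty]
      split_ifs
      · rw [hσ i hi, mul_assoc]
      · simp
    · intro i hi
      exact (h i hi).1.linear_image (LinearMap.proj (R := ℝ) (φ := fun _ : Fin (k + 1) => ℝ) 0)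
    · intro i hi
      by_cases hcpt : IsCompact (K i) ∧ σ i = 1
      · exact Or.inl ⟨hcpt.1.image (continuous_apply 0), if_pos hcpt⟩
      · rcases (h i hi).2 with h' | ⟨ho, ⟨C, hC, hKC⟩, h'⟩
        · exact absurd h' hcpt
        · exact Or.inr ⟨isOpenMap_eval 0 _ ho,
            ⟨_, hC.image (continuous_apply 0), Set.image_mono hKC⟩, if_neg hcpt⟩
    · intro t
      have := ih τ (fun i => {u | (Fin.cons t u : Fin (k + 1) → ℝ) ∈ K i}) (hslice t)
        fun u => hsum (Fin.cons t u)
      refine Eq.trans ?_ this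
      refine Finset.sum_congr rfl fun i hi => ?_
      by_cases hne : ({u | (Fin.cons t u : Fin (k + 1) → ℝ) ∈ K i} : Set (Fin k → ℝ)).Nonempty
      · rw [if_pos hne, Set.indicator_of_mem ((himage i t).2 hne)]
        simp
      · rw [if_neg hne, Set.indicator_of_notMem fun hd => hne ((himage i t).1 hd)]
        simp

open Classical in
lemma prod_indicator_sub_indicator {ι : Type*} [Fintype ι] (p q : ι → Prop) :
    ∏ i, ((if p i then (1 : ℤ) else 0) - if q i then 1 else 0) =
      ∑ S : Finset ι, (-1) ^ S.card * if ∀ i, (if i ∈ S then q i else p i) then 1 else 0 := by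
  simp only [sub_eq_neg_add]
  rw [Fintype.prod_add]
  refine Finset.sum_congr rfl fun S _ => ?_
  rw [Finset.prod_neg, mul_assoc]
  congr 1
  rw [Finset.prod_boole, Finset.prod_boole, mul_ite, mul_one, mul_zero, ← ite_and]
  congr 1
  rw [eq_iff_iff]
  constructor
  · rintro ⟨h2, h1⟩ i
    split_ifs with hi
    · exact h1 i hi
    · exact h2 i (by simpa using hi)
  · intro h
    refine ⟨fun i hi => ?_, fun i hi => ?_⟩
    · simpa [Finset.mem_compl.1 hi] using h i
    · simpa [hi] using h i

open Classical in
/-- Reciprocity for the cone spanned by the images of the standard basis vectors under `W`: the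
Euler characteristic of `{x ∈ [0, 1) ^ ι | W x = y}`, computed from closed and from open sets. -/
lemma sum_sign_cone_eq_sum_sign_open_cone {ι E : Type*} [Fintype ι] [AddCommGroup E] [Module ℝ E]
    (W : (ι → ℝ) →ₗ[ℝ] E) (hW : Function.Surjective W) (l : E → ℝ) (hl : ∀ x, l (W x) = ∑ i, x i)
    (y : E) :
    ∑ S : Finset ι, (-1 : ℤ) ^ S.card *
        (if ∃ x, (∀ i, 0 ≤ x i) ∧ W x = y - W (fun i => if i ∈ S then 1 else 0) then 1 else 0) =
      (-1) ^ Module.finrank ℝ (LinearMap.ker W) * ∑ S : Finset ι, (-1 : ℤ) ^ S.card *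
        (if ∃ x, (∀ i, 0 < x i) ∧ W x = W (fun i => if i ∈ S then 0 else 1) - y then 1 else 0) := by
  obtain ⟨x₀, rfl⟩ := hW y
  set k := Module.finrank ℝ (LinearMap.ker W) with hk
  have e : (Fin k → ℝ) ≃ₗ[ℝ] LinearMap.ker W :=
    LinearEquiv.ofFinrankEq _ _ (by simp [hk])
  set B : (Fin k → ℝ) →ₗ[ℝ] ι → ℝ := (LinearMap.ker W).subtype ∘ₗ e.toLinearMap with hB
  have hBinj : LinearMap.ker B = ⊥ := by
    rw [LinearMap.ker_eq_bot, hB]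
    exact (Submodule.injective_subtype _).comp e.injective
  obtain ⟨H, hH⟩ := B.exists_leftInverse_of_injective hBinj
  have hHB : ∀ u, H (B u) = u := fun u => LinearMap.congr_fun hH u
  have hWB : ∀ u, W (B u) = 0 := fun u => (e u).2
  have hBsurj : ∀ x, W x = 0 → ∃ u, B u = x := fun x hx =>
    ⟨e.symm ⟨x, hx⟩, by simp [hB]⟩
  have hBc : Continuous B := B.continuous_of_finiteDimensional
  have hHc : Continuous H := H.continuous_of_finiteDimensional
  have hg : Continuous fun u => x₀ + B u := by fun_prop
  have hgi : ∀ i, Continuous fun u => (x₀ + B u) i := fun i => (continuous_apply i).comp hg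
  have hcvx : ∀ {C : Set (ι → ℝ)}, Convex ℝ C → Convex ℝ {u | x₀ + B u ∈ C} := by
    intro C hC u hu w hw p q hp hq hpq
    have := hC hu hw hp hq hpq
    simp only [Set.mem_ofPred]
    convert this using 1
    simp only [map_add, map_smul, smul_add]
    rw [add_add_add_comm, ← add_smul, hpq, one_smul]
  have hbox : ∀ (c d : ι → ℝ) (K : Set (Fin k → ℝ)), (∀ u ∈ K, x₀ + B u ∈ Set.Icc c d) →
      ∃ C, IsCompact C ∧ K ⊆ C := by
    intro c d K hK
    refine ⟨(fun x => H (x - x₀)) '' Set.Icc c d, isCompact_Icc.image (by fun_prop), ?_⟩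
    intro u hu
    exact ⟨_, hK u hu, by simp [hHB]⟩
  have hsumB : ∀ u, ∑ i, (x₀ + B u) i = ∑ i, x₀ i := by
    intro u
    rw [← hl, ← hl, map_add, hWB, add_zero]
  set Kc : Finset ι → Set (Fin k → ℝ) := fun S =>
    {u | ∀ i, if i ∈ S then 1 ≤ (x₀ + B u) i else 0 ≤ (x₀ + B u) i}
  set Ko : Finset ι → Set (Fin k → ℝ) := fun S =>
    {u | ∀ i, if i ∈ S then (x₀ + B u) i < 0 else (x₀ + B u) i < 1} with hKo
  have hKc' : ∀ S u, u ∈ Kc S ↔ ∀ i, (if i ∈ S then 1 else 0) ≤ (x₀ + B u) i := by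
    intro S u
    refine forall_congr' fun i => ?_
    split_ifs <;> rfl
  have hKo' : ∀ S u, u ∈ Ko S ↔ ∀ i, (x₀ + B u) i < (if i ∈ S then 0 else 1) := by
    intro S u
    refine forall_congr' fun i => ?_
    split_ifs <;> rfl
  have hcompact : ∀ S, HasEulerSign k (Kc S) 1 := by
    intro S
    have hset : Kc S = {u | x₀ + B u ∈ Set.Ici (fun i => if i ∈ S then (1 : ℝ) else 0)} :=
      Set.ext fun u => hKc' S u
    refine ⟨?_, Or.inl ⟨?_, rfl⟩⟩
    · rw [hset]
      exact hcvx (convex_Ici _)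
    · obtain ⟨C, hC, hKC⟩ := hbox (fun _ => 0) (fun _ => ∑ i, x₀ i) (Kc S) (by
        intro u hu
        have h0 : ∀ i, 0 ≤ (x₀ + B u) i := fun i => by
          refine le_trans ?_ ((hKc' S u).1 hu i)
          split_ifs <;> norm_num
        refine ⟨h0, fun i => ?_⟩
        simp only
        rw [← hsumB u]
        exact Finset.single_le_sum (fun j _ => h0 j) (Finset.mem_univ i))
      refine hC.of_isClosed_subset ?_ hKC
      rw [hset]
      exact isClosed_Ici.preimage hg
  have hopen : ∀ S, HasEulerSign k (Ko S) ((-1) ^ k) := by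
    intro S
    refine ⟨?_, Or.inr ⟨?_, ?_, rfl⟩⟩
    · have hset : Ko S = {u | x₀ + B u ∈ Set.univ.pi
          (fun i => Set.Iio (if i ∈ S then (0 : ℝ) else 1))} :=
        Set.ext fun u => by simp only [hKo', Set.mem_ofPred, Set.mem_univ_pi, Set.mem_Iio]
      rw [hset]
      exact hcvx (convex_pi fun i _ => convex_Iio _)
    · have hset : Ko S = ⋂ i, {u | (x₀ + B u) i < (if i ∈ S then 0 else 1)} :=
        Set.ext fun u => by simp only [hKo', Set.mem_iInter, Set.mem_ofPred]
      rw [hset]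
      exact isOpen_iInter_of_finite fun i => isOpen_lt (hgi i) continuous_const
    · refine hbox (fun _ => 1 - ∑ i, (1 - x₀ i)) (fun _ => 1) (Ko S) fun u hu => ?_
      have h1 : ∀ i, (x₀ + B u) i ≤ 1 := fun i => by
        refine ((hKo' S u).1 hu i).le.trans ?_
        split_ifs <;> norm_num
      refine ⟨fun i => ?_, h1⟩
      have h2 : 1 - (x₀ + B u) i ≤ ∑ j, (1 - (x₀ + B u) j) :=
        Finset.single_le_sum (f := fun j => 1 - (x₀ + B u) j)
          (fun j _ => sub_nonneg.2 (h1 j)) (Finset.mem_univ i)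
      rw [Finset.sum_sub_distrib, hsumB, ← Finset.sum_sub_distrib] at h2
      simp only
      linarith
  have hpoint : ∀ u, ∑ S : Finset ι, (-1 : ℤ) ^ S.card * (Kc S).indicator 1 u =
      ∑ S : Finset ι, (-1 : ℤ) ^ S.card * (Ko S).indicator 1 u := by
    intro u
    have h1 := prod_indicator_sub_indicator (fun i => 0 ≤ (x₀ + B u) i) (fun i => 1 ≤ (x₀ + B u) i)
    have h2 := prod_indicator_sub_indicator (fun i => (x₀ + B u) i < 1) (fun i => (x₀ + B u) i < 0)
    simp only [Set.indicator_apply, Pi.one_apply]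
    refine (h1.symm.trans ?_).trans h2
    refine Finset.prod_congr rfl fun i _ => ?_
    generalize (x₀ + B u) i = r
    rcases lt_or_ge r 0 with h | h
    · simp [h, h.not_ge, h.trans one_pos, (h.trans one_pos).not_ge]
    · rcases lt_or_ge r 1 with h' | h'
      · simp [h, h', h.not_gt, h'.not_ge]
      · simp [h, h', h.not_gt, h'.not_gt]
  have heuler := sum_eulerSign_eq_zero (Finset.univ : Finset (Finset ι ⊕ Finset ι)) k
    (Sum.elim (fun S => (-1) ^ S.card) (fun S => -(-1) ^ S.card))
    (Sum.elim (fun _ => 1) (fun _ => (-1) ^ k)) (Sum.elim Kc Ko)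
    (by rintro (S | S) - <;> simp [hcompact, hopen])
    (by
      intro u
      rw [Fintype.sum_sum_type]
      simp only [Sum.elim_inl, Sum.elim_inr, neg_mul, Finset.sum_neg_distrib, hpoint u]
      exact add_neg_cancel _)
  rw [Fintype.sum_sum_type] at heuler
  simp only [Sum.elim_inl, Sum.elim_inr, neg_mul, Finset.sum_neg_distrib] at heuler
  rw [add_neg_eq_zero] at heuler
  have hcl : ∀ S : Finset ι, (Kc S).Nonempty ↔
      ∃ x, (∀ i, 0 ≤ x i) ∧ W x = W x₀ - W (fun i => if i ∈ S then 1 else 0) := by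
    intro S
    constructor
    · rintro ⟨u, hu⟩
      refine ⟨x₀ + B u - fun i => if i ∈ S then 1 else 0, fun i => ?_, ?_⟩
      · have := (hKc' S u).1 hu i
        simp only [Pi.sub_apply]
        linarith
      · rw [map_sub, map_add, hWB, add_zero]
    · rintro ⟨x, hx, hWx⟩
      obtain ⟨u, hu⟩ := hBsurj (x + (fun i => if i ∈ S then 1 else 0) - x₀) (by
        rw [map_sub, map_add, hWx]; abel)
      refine ⟨u, (hKc' S u).2 fun i => ?_⟩
      rw [hu]
      simpa using hx i
  have hop : ∀ S : Finset ι, (Ko S).Nonempty ↔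
      ∃ x, (∀ i, 0 < x i) ∧ W x = W (fun i => if i ∈ S then 0 else 1) - W x₀ := by
    intro S
    constructor
    · rintro ⟨u, hu⟩
      refine ⟨(fun i => if i ∈ S then 0 else 1) - (x₀ + B u), fun i => ?_, ?_⟩
      · have := (hKo' S u).1 hu i
        simp only [Pi.sub_apply]
        linarith
      · rw [map_sub, map_add, hWB, add_zero]
    · rintro ⟨x, hx, hWx⟩
      obtain ⟨u, hu⟩ := hBsurj ((fun i => if i ∈ S then 0 else 1) - x - x₀) (by
        rw [map_sub, map_sub, hWx]; abel)
      refine ⟨u, (hKo' S u).2 fun i => ?_⟩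
      rw [hu]
      simpa using hx i
  simp only [hcl, hop] at heuler
  rw [heuler, Finset.mul_sum]
  refine Finset.sum_congr rfl fun S _ => ?_
  split_ifs <;> ring

/-- The combinations of the `v i` with nonnegative coefficients of sum `m`. -/
def nonnegCombos {ι : Type*} [Fintype ι] {d : ℕ} (v : ι → Fin d → ℝ) (m : ℝ) : Set (Fin d → ℝ) :=
  {x | ∃ c : ι → ℝ, (∀ i, 0 ≤ c i) ∧ ∑ i, c i = m ∧ ∑ i, c i • v i = x}

/-- The combinations of the `v i` with positive coefficients of sum `m`. -/
def posCombos {ι : Type*} [Fintype ι] {d : ℕ} (v : ι → Fin d → ℝ) (m : ℝ) : Set (Fin d → ℝ) :=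
  {x | ∃ c : ι → ℝ, (∀ i, 0 < c i) ∧ ∑ i, c i = m ∧ ∑ i, c i • v i = x}

/-- The real vector with the same coordinates as an integer vector. -/
def castVec {d : ℕ} (x : Fin d → ℤ) : Fin d → ℝ := fun i => (x i : ℝ)

section Combos

variable {ι : Type*} [Fintype ι] {d : ℕ}

lemma posCombos_subset_nonnegCombos (v : ι → Fin d → ℝ) (m : ℝ) :
    posCombos v m ⊆ nonnegCombos v m := by
  rintro x ⟨c, hc, hm, hx⟩
  exact ⟨c, fun i => (hc i).le, hm, hx⟩

lemma convexHull_range_eq_nonnegCombos (v : ι → Fin d → ℝ) :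
    convexHull ℝ (Set.range v) = nonnegCombos v 1 := by
  classical
  apply Set.Subset.antisymm
  · refine convexHull_min ?_ ?_
    · rintro _ ⟨i, rfl⟩
      refine ⟨fun j => if j = i then 1 else 0, fun j => ?_, by simp, by simp⟩
      dsimp only
      split_ifs <;> norm_num
    · rintro _ ⟨c, hc, hc1, rfl⟩ _ ⟨c', hc', hc1', rfl⟩ p q hp hq hpq
      refine ⟨fun i => p * c i + q * c' i, fun i => ?_, ?_, ?_⟩
      · exact add_nonneg (mul_nonneg hp (hc i)) (mul_nonneg hq (hc' i))
      · rw [Finset.sum_add_distrib, ← Finset.mul_sum, ← Finset.mul_sum, hc1, hc1', mul_one,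
          mul_one, hpq]
      · simp only [add_smul, mul_smul, Finset.sum_add_distrib, Finset.smul_sum]
  · rintro _ ⟨c, hc, hc1, rfl⟩
    exact (convex_convexHull ℝ _).sum_mem (fun i _ => hc i) hc1
      fun i _ => subset_convexHull ℝ _ ⟨i, rfl⟩

lemma smul_nonnegCombos (v : ι → Fin d → ℝ) {r : ℝ} (hr : 0 < r) (m : ℝ) :
    r • nonnegCombos v m = nonnegCombos v (r * m) := by
  ext x
  constructor
  · rintro ⟨_, ⟨c, hc, rfl, rfl⟩, rfl⟩
    exact ⟨fun i => r * c i, fun i => mul_nonneg hr.le (hc i), by rw [Finset.mul_sum],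
      by simp only [Finset.smul_sum, mul_smul]⟩
  · rintro ⟨c, hc, hm, rfl⟩
    refine ⟨_, ⟨fun i => r⁻¹ * c i, fun i => mul_nonneg (inv_nonneg.2 hr.le) (hc i), ?_, rfl⟩, ?_⟩
    · rw [← Finset.mul_sum, hm, inv_mul_cancel_left₀ hr.ne']
    · simp only [Finset.smul_sum, mul_smul, smul_inv_smul₀ hr.ne']

lemma nonnegCombos_zero (v : ι → Fin d → ℝ) : nonnegCombos v 0 = {0} := by
  ext x
  constructor
  · rintro ⟨c, hc, hm, rfl⟩
    have h0 : ∀ i, c i = 0 := fun i =>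
      (Finset.sum_eq_zero_iff_of_nonneg fun i _ => hc i).1 hm i (Finset.mem_univ i)
    simp [h0]
  · rintro rfl
    exact ⟨0, fun _ => le_rfl, by simp, by simp⟩

lemma natCast_smul_nonnegCombos_one {v : ι → Fin d → ℝ} (hne : (nonnegCombos v 1).Nonempty)
    (m : ℕ) : (m : ℝ) • nonnegCombos v 1 = nonnegCombos v m := by
  rcases m.eq_zero_or_pos with rfl | hm
  · rw [Nat.cast_zero, Set.zero_smul_set hne, nonnegCombos_zero]
    rfl
  · rw [smul_nonnegCombos v (by exact_mod_cast hm), mul_one]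

lemma nonnegCombos_of_neg (v : ι → Fin d → ℝ) {m : ℝ} (hm : m < 0) : nonnegCombos v m = ∅ := by
  refine Set.eq_empty_of_forall_notMem ?_
  rintro x ⟨c, hc, rfl, -⟩
  exact absurd (Finset.sum_nonneg fun i _ => hc i) (not_le.2 hm)

lemma posCombos_of_nonpos [Nonempty ι] (v : ι → Fin d → ℝ) {m : ℝ} (hm : m ≤ 0) :
    posCombos v m = ∅ := by
  refine Set.eq_empty_of_forall_notMem ?_
  rintro x ⟨c, hc, rfl, -⟩
  exact absurd (Finset.sum_pos (fun i _ => hc i) Finset.univ_nonempty) (not_lt.2 hm)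

lemma abs_le_of_mem_nonnegCombos {v : ι → Fin d → ℝ} {R m : ℝ} (hR : ∀ i j, |v i j| ≤ R)
    {x : Fin d → ℝ} (hx : x ∈ nonnegCombos v m) (j : Fin d) : |x j| ≤ m * R := by
  obtain ⟨c, hc, rfl, rfl⟩ := hx
  rw [Finset.sum_apply, Finset.sum_mul]
  refine (Finset.abs_sum_le_sum_abs _ _).trans (Finset.sum_le_sum fun i _ => ?_)
  rw [Pi.smul_apply, smul_eq_mul, abs_mul, abs_of_nonneg (hc i)]
  exact mul_le_mul_of_nonneg_left (hR i j) (hc i)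

lemma exists_abs_castVec_le (v : ι → Fin d → ℤ) :
    ∃ R : ℕ, ∀ i j, |castVec (v i) j| ≤ (R : ℝ) := by
  refine ⟨∑ i, ∑ j, (v i j).natAbs, fun i j => ?_⟩
  have h : (v i j).natAbs ≤ ∑ i, ∑ j, (v i j).natAbs :=
    (Finset.single_le_sum (f := fun j => (v i j).natAbs) (fun _ _ => Nat.zero_le _)
      (Finset.mem_univ j)).trans
    (Finset.single_le_sum (f := fun i => ∑ j, (v i j).natAbs) (fun _ _ => Nat.zero_le _)
      (Finset.mem_univ i))
  have h' : |castVec (v i) j| = ((v i j).natAbs : ℝ) := by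
    rw [Nat.cast_natAbs, Int.cast_abs]
    rfl
  rw [h']
  exact_mod_cast h

lemma latticePts_nonnegCombos_subset_Icc {v : ι → Fin d → ℤ} {R : ℕ}
    (hR : ∀ i j, |castVec (v i) j| ≤ (R : ℝ)) {m : ℝ} {k : ℕ} (hmk : m ≤ k) :
    latticePts d (nonnegCombos (fun i => castVec (v i)) m) ⊆
      Set.Icc (fun _ => -((k * R : ℕ) : ℤ)) (fun _ => ((k * R : ℕ) : ℤ)) := by
  intro x hx
  have h : ∀ j, |x j| ≤ ((k * R : ℕ) : ℤ) := by
    intro j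
    have h1 : |((x j : ℤ) : ℝ)| ≤ m * R := abs_le_of_mem_nonnegCombos hR hx j
    have h2 : m * R ≤ k * R := mul_le_mul_of_nonneg_right hmk (Nat.cast_nonneg R)
    exact_mod_cast h1.trans h2
  exact ⟨fun j => (abs_le.1 (h j)).1, fun j => (abs_le.1 (h j)).2⟩

lemma finite_latticePts_nonnegCombos (v : ι → Fin d → ℤ) (m : ℝ) :
    (latticePts d (nonnegCombos (fun i => castVec (v i)) m)).Finite := by
  obtain ⟨R, hR⟩ := exists_abs_castVec_le v
  obtain ⟨k, hk⟩ := exists_nat_ge m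
  exact (Set.finite_Icc _ _).subset (latticePts_nonnegCombos_subset_Icc hR hk)

lemma ncard_latticePts_nonnegCombos_le {v : ι → Fin d → ℤ} {R : ℕ}
    (hR : ∀ i j, |castVec (v i) j| ≤ (R : ℝ)) (k : ℕ) :
    (latticePts d (nonnegCombos (fun i => castVec (v i)) k)).ncard ≤ (2 * R * k + 1) ^ d := by
  refine (Set.ncard_le_ncard (latticePts_nonnegCombos_subset_Icc hR le_rfl)
    (Set.finite_Icc _ _)).trans (le_of_eq ?_)
  rw [← Finset.coe_Icc, Set.ncard_coe_finset, Pi.card_Icc]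
  simp only [Int.card_Icc, Finset.prod_const, Finset.card_univ, Fintype.card_fin]
  congr 1
  have : ((k * R : ℕ) : ℤ) + 1 - -((k * R : ℕ) : ℤ) = ((2 * R * k + 1 : ℕ) : ℤ) := by
    push_cast
    ring
  rw [this, Int.toNat_natCast]

/-- A convex combination of the `v i` with positive coefficients represents any interior point
of their convex hull; here the point is the origin. -/
lemma zero_mem_posCombos_one [Nonempty ι] {v : ι → Fin d → ℝ}
    (h0 : (0 : Fin d → ℝ) ∈ interior (nonnegCombos v 1)) : (0 : Fin d → ℝ) ∈ posCombos v 1 := by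
  set s : Fin d → ℝ := ∑ i, v i
  have hcont : Filter.Tendsto (fun t : ℝ => -(t • s)) (nhdsWithin 0 (Set.Ioi 0)) (nhds 0) := by
    have : Continuous fun t : ℝ => -(t • s) := by fun_prop
    simpa using (this.tendsto 0).mono_left nhdsWithin_le_nhds
  obtain ⟨t, ht, ht0⟩ := ((hcont.eventually (mem_interior_iff_mem_nhds.1 h0)).and
    self_mem_nhdsWithin).exists
  obtain ⟨c, hc, hc1, hcs⟩ := ht
  have ht0' : 0 < t := ht0
  have hn : (0 : ℝ) ≤ Fintype.card ι := Nat.cast_nonneg _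
  have hD : 0 < 1 + Fintype.card ι * t := by positivity
  refine ⟨fun i => (1 + Fintype.card ι * t)⁻¹ * (c i + t), fun i => ?_, ?_, ?_⟩
  · exact mul_pos (inv_pos.2 hD) (add_pos_of_nonneg_of_pos (hc i) ht0')
  · rw [← Finset.mul_sum, Finset.sum_add_distrib, hc1, Finset.sum_const, Finset.card_univ,
      nsmul_eq_mul, inv_mul_cancel₀ hD.ne']
  · simp only [mul_smul, add_smul, ← Finset.smul_sum, Finset.sum_add_distrib]
    rw [hcs, neg_add_cancel, smul_zero]

/-- The map sending a coefficient vector to the combination of the `v i`, with the sum of the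
coefficients as an additional coordinate. -/
def homogenization (v : ι → Fin d → ℝ) : (ι → ℝ) →ₗ[ℝ] (Fin d → ℝ) × ℝ :=
  (Fintype.linearCombination ℝ v).prod (Fintype.linearCombination ℝ fun _ => (1 : ℝ))

lemma homogenization_apply (v : ι → Fin d → ℝ) (c : ι → ℝ) :
    homogenization v c = (∑ i, c i • v i, ∑ i, c i) := by
  simp [homogenization, Fintype.linearCombination_apply]

lemma surjective_homogenization [Nonempty ι] {v : ι → Fin d → ℝ}
    (h0 : (0 : Fin d → ℝ) ∈ interior (nonnegCombos v 1)) :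
    Function.Surjective (homogenization v) := by
  rintro ⟨x, r⟩
  obtain ⟨c, -, hc1, hc0⟩ := zero_mem_posCombos_one h0
  have hcont : Filter.Tendsto (fun t : ℝ => t • x) (nhdsWithin 0 (Set.Ioi 0)) (nhds 0) := by
    have : Continuous fun t : ℝ => t • x := by fun_prop
    simpa using (this.tendsto 0).mono_left nhdsWithin_le_nhds
  obtain ⟨t, ⟨b, -, hb1, hbx⟩, ht0⟩ :=
    ((hcont.eventually (mem_interior_iff_mem_nhds.1 h0)).and self_mem_nhdsWithin).exists
  have ht0' : 0 < t := ht0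
  refine ⟨t⁻¹ • b + (r - t⁻¹) • c, ?_⟩
  have hb : homogenization v b = (t • x, 1) := by rw [homogenization_apply, hb1, hbx]
  have hc : homogenization v c = (0, 1) := by rw [homogenization_apply, hc1, hc0]
  rw [map_add, map_smul, map_smul, hb, hc]
  simp [inv_smul_smul₀ ht0'.ne']

lemma finrank_ker_homogenization [Nonempty ι] {v : ι → Fin d → ℝ}
    (h0 : (0 : Fin d → ℝ) ∈ interior (nonnegCombos v 1)) :
    d + 1 + Module.finrank ℝ (LinearMap.ker (homogenization v)) = Fintype.card ι := by
  have h := (homogenization v).finrank_range_add_finrank_ker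
  rw [LinearMap.range_eq_top.2 (surjective_homogenization h0), finrank_top] at h
  simpa using h

end Combos

open Classical in
/-- A linear relation between indicators of finite sets is also satisfied by their
cardinalities. -/
lemma sum_mul_ncard_eq_zero {ι α : Type*} (s : Finset ι) (c : ι → ℤ) (T : ι → Set α)
    (hT : ∀ i ∈ s, (T i).Finite) (h : ∀ x, ∑ i ∈ s, c i * (if x ∈ T i then 1 else 0) = 0) :
    ∑ i ∈ s, c i * ((T i).ncard : ℤ) = 0 := by
  have hfin : (⋃ i ∈ s, T i).Finite := s.finite_toSet.biUnion fun i hi => hT i hi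
  have hcard : ∀ i ∈ s, ((T i).ncard : ℤ) = ∑ x ∈ hfin.toFinset, if x ∈ T i then 1 else 0 := by
    intro i hi
    rw [Finset.sum_boole, ← Set.ncard_coe_finset]
    congr 2
    ext x
    simp only [Finset.coe_filter, Set.Finite.mem_toFinset, Set.mem_ofPred]
    exact ⟨fun hx => ⟨Set.mem_biUnion hi hx, hx⟩, fun hx => hx.2⟩
  rw [Finset.sum_congr rfl fun i hi => congrArg (c i * ·) (hcard i hi)]
  simp only [Finset.mul_sum]
  rw [Finset.sum_comm]
  exact Finset.sum_eq_zero fun x _ => h x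

section Reciprocity

variable {ι : Type*} [Fintype ι] [Nonempty ι] {d : ℕ}

open Classical in
lemma sum_sign_mem_nonnegCombos {v : ι → Fin d → ℤ}
    (h0 : (0 : Fin d → ℝ) ∈ interior (nonnegCombos (fun i => castVec (v i)) 1))
    (h : ℤ) (x : Fin d → ℤ) :
    ∑ S : Finset ι, (-1 : ℤ) ^ S.card * (if x - ∑ i ∈ S, v i ∈
        latticePts d (nonnegCombos (fun i => castVec (v i)) ((h - S.card : ℤ) : ℝ)) then 1 else 0) =
      (-1) ^ (d + 1) * ∑ S : Finset ι, (-1 : ℤ) ^ S.card * (if ∑ i ∈ S, v i - x ∈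
        latticePts d (posCombos (fun i => castVec (v i)) ((S.card - h : ℤ) : ℝ)) then 1 else 0) := by
  set w : ι → Fin d → ℝ := fun i => castVec (v i) with hw
  have hcast : ∀ S : Finset ι, castVec (∑ i ∈ S, v i) = ∑ i ∈ S, w i := by
    intro S
    ext j
    simp [castVec, hw, Finset.sum_apply]
  have hsub : ∀ x y : Fin d → ℤ, castVec (x - y) = castVec x - castVec y := by
    intro x y
    ext j
    simp [castVec]
  have hind : ∀ S : Finset ι, homogenization w (fun i => if i ∈ S then 1 else 0) =
      (∑ i ∈ S, w i, (S.card : ℝ)) := by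
    intro S
    rw [homogenization_apply]
    simp
  have hind' : ∀ S : Finset ι, homogenization w (fun i => if i ∈ Sᶜ then 0 else 1) =
      (∑ i ∈ S, w i, (S.card : ℝ)) := by
    intro S
    rw [← hind S]
    congr 1
    ext i
    by_cases hi : i ∈ S <;> simp [hi]
  have key := sum_sign_cone_eq_sum_sign_open_cone (homogenization w) (surjective_homogenization h0)
    Prod.snd (fun c => by rw [homogenization_apply]) (castVec x, (h : ℝ))
  have hcard := finrank_ker_homogenization h0
  have hL : ∀ S : Finset ι, (∃ c : ι → ℝ, (∀ i, 0 ≤ c i) ∧ homogenization w c =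
      (castVec x, (h : ℝ)) - homogenization w (fun i => if i ∈ S then 1 else 0)) ↔
      x - ∑ i ∈ S, v i ∈ latticePts d (nonnegCombos w ((h - S.card : ℤ) : ℝ)) := by
    intro S
    change _ ↔ castVec (x - ∑ i ∈ S, v i) ∈ nonnegCombos w _
    refine exists_congr fun c => and_congr_right fun _ => ?_
    rw [hind, homogenization_apply, hsub, hcast, Prod.mk_sub_mk, Prod.mk.injEq, and_comm]
    push_cast
    rfl
  have hR : ∀ S : Finset ι, (∃ c : ι → ℝ, (∀ i, 0 < c i) ∧ homogenization w c =
      homogenization w (fun i => if i ∈ Sᶜ then 0 else 1) - (castVec x, (h : ℝ))) ↔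
      ∑ i ∈ S, v i - x ∈ latticePts d (posCombos w ((S.card - h : ℤ) : ℝ)) := by
    intro S
    change _ ↔ castVec (∑ i ∈ S, v i - x) ∈ posCombos w _
    refine exists_congr fun c => and_congr_right fun _ => ?_
    rw [hind', homogenization_apply, hsub, hcast, Prod.mk_sub_mk, Prod.mk.injEq, and_comm]
    push_cast
    rfl
  simp only [hL] at key
  rw [key, ← compl_bijective.sum_comp, Finset.mul_sum, Finset.mul_sum]
  refine Finset.sum_congr rfl fun S _ => ?_
  simp only [hR]
  rw [← mul_assoc, ← mul_assoc]
  congr 1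
  have hSc : S.card + Sᶜ.card = Fintype.card ι := Finset.card_add_card_compl S
  rw [← pow_add, ← pow_add]
  refine neg_one_pow_congr ?_
  simp only [Nat.even_iff]
  omega

lemma sum_sign_ncard_nonnegCombos {v : ι → Fin d → ℤ}
    (h0 : (0 : Fin d → ℝ) ∈ interior (nonnegCombos (fun i => castVec (v i)) 1)) (h : ℤ) :
    ∑ S : Finset ι, (-1 : ℤ) ^ S.card * ((latticePts d
        (nonnegCombos (fun i => castVec (v i)) ((h - S.card : ℤ) : ℝ))).ncard : ℤ) =
      (-1) ^ (d + 1) * ∑ S : Finset ι, (-1 : ℤ) ^ S.card * ((latticePts d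
        (posCombos (fun i => castVec (v i)) ((S.card - h : ℤ) : ℝ))).ncard : ℤ) := by
  classical
  set A : Finset ι → Set (Fin d → ℤ) := fun S =>
    latticePts d (nonnegCombos (fun i => castVec (v i)) ((h - S.card : ℤ) : ℝ)) with hA
  set B : Finset ι → Set (Fin d → ℤ) := fun S =>
    latticePts d (posCombos (fun i => castVec (v i)) ((S.card - h : ℤ) : ℝ)) with hB
  have hAfin : ∀ S, (A S).Finite := fun S => finite_latticePts_nonnegCombos v _
  have hBfin : ∀ S, (B S).Finite := fun S => (finite_latticePts_nonnegCombos v _).subset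
    fun x hx => posCombos_subset_nonnegCombos _ _ hx
  have hAcard : ∀ S, ((Equiv.subRight (∑ i ∈ S, v i)) ⁻¹' A S).ncard = (A S).ncard := fun S =>
    Set.ncard_preimage_of_injective_subset_range (Equiv.injective _) (by simp)
  have hBcard : ∀ S, ((Equiv.subLeft (∑ i ∈ S, v i)) ⁻¹' B S).ncard = (B S).ncard := fun S =>
    Set.ncard_preimage_of_injective_subset_range (Equiv.injective _) (by simp)
  have key := sum_mul_ncard_eq_zero (Finset.univ : Finset (Finset ι ⊕ Finset ι))
    (Sum.elim (fun S => (-1) ^ S.card) (fun S => -((-1) ^ (d + 1) * (-1) ^ S.card)))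
    (Sum.elim (fun S => (Equiv.subRight (∑ i ∈ S, v i)) ⁻¹' A S)
      (fun S => (Equiv.subLeft (∑ i ∈ S, v i)) ⁻¹' B S))
    (by
      rintro (S | S) -
      · exact (hAfin S).preimage (Equiv.injective _).injOn
      · exact (hBfin S).preimage (Equiv.injective _).injOn)
    (by
      intro x
      rw [Fintype.sum_sum_type]
      simp only [Sum.elim_inl, Sum.elim_inr, neg_mul, Finset.sum_neg_distrib, mul_assoc,
        ← Finset.mul_sum, Set.mem_preimage, Equiv.subRight_apply, Equiv.subLeft_apply]
      rw [add_neg_eq_zero]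
      exact sum_sign_mem_nonnegCombos h0 h x)
  rw [Fintype.sum_sum_type] at key
  simp only [Sum.elim_inl, Sum.elim_inr, neg_mul, Finset.sum_neg_distrib, mul_assoc,
    ← Finset.mul_sum, hAcard, hBcard] at key
  rwa [add_neg_eq_zero] at key

end Reciprocity

/-- A point is in a closed convex set containing the origin as soon as it satisfies all the
inequalities given by the dual body. -/
lemma mem_of_forall_mem_dualBody {d : ℕ} {P : Set (Fin d → ℝ)} (hc : Convex ℝ P)
    (hcl : IsClosed P) (h0 : (0 : Fin d → ℝ) ∈ P) {x : Fin d → ℝ}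
    (hx : ∀ u ∈ dualBody d P, -1 ≤ ∑ i, u i * x i) : x ∈ P := by
  by_contra hxP
  obtain ⟨f, r, hf, hr⟩ := geometric_hahn_banach_closed_point hc hcl hxP
  have hr0 : 0 < r := by simpa using hf 0 h0
  have hfx : ∀ y : Fin d → ℝ, ∑ i, -(f (Pi.single i 1)) / r * y i = -(f y) / r := by
    intro y
    have hy : f y = ∑ i, y i * f (Pi.single i 1) := by
      conv_lhs => rw [pi_eq_sum_univ' y]
      rw [map_sum]
      refine Finset.sum_congr rfl fun i _ => ?_
      rw [map_smul, smul_eq_mul]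
    rw [hy, ← Finset.sum_neg_distrib, Finset.sum_div]
    exact Finset.sum_congr rfl fun i _ => by ring
  have h1 := hx (fun i => -(f (Pi.single i 1)) / r) fun y hy => by
    rw [hfx, le_div_iff₀ hr0]
    linarith [hf y hy]
  rw [hfx, le_div_iff₀ hr0] at h1
  linarith

/-- For a reflexive polytope, the lattice points in the interior of a dilate are the lattice
points of the previous dilate. -/
lemma latticePts_posCombos_eq {ι : Type*} [Fintype ι] [Nonempty ι] {d : ℕ} {v : ι → Fin d → ℤ}
    (href : IsReflexive d (nonnegCombos (fun i => castVec (v i)) 1)) (m : ℕ) :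
    latticePts d (posCombos (fun i => castVec (v i)) (m + 1)) =
      latticePts d (nonnegCombos (fun i => castVec (v i)) m) := by
  set w : ι → Fin d → ℝ := fun i => castVec (v i) with hw
  obtain ⟨h0, U, hU⟩ := href
  have h0P : (0 : Fin d → ℝ) ∈ nonnegCombos w 1 := interior_subset h0
  have hPc : Convex ℝ (nonnegCombos w 1) := by
    rw [← convexHull_range_eq_nonnegCombos]
    exact convex_convexHull ℝ _
  have hPcl : IsClosed (nonnegCombos w 1) := by
    rw [← convexHull_range_eq_nonnegCombos]
    exact ((Set.finite_range w).isCompact_convexHull (𝕜 := ℝ)).isClosed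
  have hwP : ∀ i, w i ∈ nonnegCombos w 1 := fun i => by
    rw [← convexHull_range_eq_nonnegCombos]
    exact subset_convexHull ℝ _ ⟨i, rfl⟩
  have hdot : ∀ (u : Fin d → ℝ) (c : ι → ℝ),
      ∑ j, u j * (∑ i, c i • w i) j = ∑ i, c i * ∑ j, u j * w i j := by
    intro u c
    simp only [Finset.sum_apply, Finset.mul_sum, Pi.smul_apply, smul_eq_mul]
    rw [Finset.sum_comm]
    exact Finset.sum_congr rfl fun i _ => Finset.sum_congr rfl fun j _ => by ring
  have hdual : ∀ (x : Fin d → ℝ) (r : ℝ), (∀ u ∈ U, r ≤ ∑ j, castVec u j * x j) →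
      ∀ u ∈ dualBody d (nonnegCombos w 1), r ≤ ∑ j, u j * x j := by
    intro x r h u hu
    rw [hU] at hu
    have hconv : Convex ℝ {u : Fin d → ℝ | r ≤ ∑ j, u j * x j} := by
      intro a ha b hb p q hp hq hpq
      simp only [Set.mem_ofPred] at ha hb ⊢
      have : ∑ j, (p • a + q • b) j * x j = p * ∑ j, a j * x j + q * ∑ j, b j * x j := by
        simp only [Finset.mul_sum, ← Finset.sum_add_distrib, Pi.add_apply, Pi.smul_apply,
          smul_eq_mul]
        exact Finset.sum_congr rfl fun j _ => by ring
      rw [this]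
      calc r = p * r + q * r := by rw [← add_mul, hpq, one_mul]
        _ ≤ _ := add_le_add (mul_le_mul_of_nonneg_left ha hp) (mul_le_mul_of_nonneg_left hb hq)
    refine convexHull_min ?_ hconv hu
    rintro _ ⟨u, hu, rfl⟩
    exact h u hu
  ext x
  constructor
  · rintro ⟨c, hc, hcm, hcx⟩
    change castVec x ∈ nonnegCombos w m
    change _ = castVec x at hcx
    have hineq : ∀ u ∈ U, -(m : ℝ) ≤ ∑ j, castVec u j * castVec x j := by
      intro u hu
      have huD : castVec u ∈ dualBody d (nonnegCombos w 1) := by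
        rw [hU]
        exact subset_convexHull ℝ _ ⟨u, hu, rfl⟩
      have hge : ∀ i, -1 ≤ ∑ j, castVec u j * w i j := fun i => huD _ (hwP i)
      have hlt : -((m : ℝ) + 1) < ∑ j, castVec u j * castVec x j := by
        by_contra hcon
        have hsum : ∑ i, c i * (1 + ∑ j, castVec u j * w i j) ≤ 0 := by
          simp only [mul_add, mul_one, Finset.sum_add_distrib]
          rw [hcm, ← hdot, hcx]
          linarith
        have hz : ∀ i, ∑ j, castVec u j * w i j = -1 := by
          intro i
          have h1 : ∀ i, 0 ≤ c i * (1 + ∑ j, castVec u j * w i j) := fun i =>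
            mul_nonneg (hc i).le (by linarith [hge i])
          have h2 := (Finset.sum_eq_zero_iff_of_nonneg fun i _ => h1 i).1
            (le_antisymm hsum (Finset.sum_nonneg fun i _ => h1 i)) i (Finset.mem_univ i)
          rcases mul_eq_zero.1 h2 with h3 | h3
          · exact absurd h3 (hc i).ne'
          · linarith
        obtain ⟨b, -, hb1, hb0⟩ := h0P
        have h3 := hdot (castVec u) b
        rw [hb0] at h3
        simp only [hz, ← Finset.sum_mul, hb1] at h3
        norm_num at h3
      have hint : ∑ j, castVec u j * castVec x j = ((∑ j, u j * x j : ℤ) : ℝ) := by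
        push_cast
        rfl
      rw [hint] at hlt ⊢
      have : -((m : ℤ) + 1) < ∑ j, u j * x j := by exact_mod_cast hlt
      have : -(m : ℤ) ≤ ∑ j, u j * x j := by linarith
      exact_mod_cast this
    rcases m.eq_zero_or_pos with rfl | hm
    · rw [Nat.cast_zero, nonnegCombos_zero]
      obtain ⟨R, hR⟩ := exists_abs_castVec_le v
      have hbound : ∀ (s : ℝ), |s| ≤ 1 → ∀ j, 0 ≤ s * castVec x j := by
        intro s hs j
        have hR1 : (0 : ℝ) < R + 1 := by positivity
        have := hdual (castVec x) 0 (by simpa using hineq) (Pi.single j (s / (R + 1))) (by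
          intro p hp
          have hpj := abs_le_of_mem_nonnegCombos hR hp j
          rw [one_mul] at hpj
          simp only [Pi.single_apply, ite_mul, zero_mul, Finset.sum_ite_eq', Finset.mem_univ,
            if_true]
          refine (abs_le.1 ?_).1
          rw [abs_mul, abs_div, abs_of_pos hR1, div_mul_eq_mul_div, div_le_one hR1]
          calc |s| * |p j| ≤ 1 * R := mul_le_mul hs hpj (abs_nonneg _) zero_le_one
            _ ≤ R + 1 := by linarith)
        simp only [Pi.single_apply, ite_mul, zero_mul, Finset.sum_ite_eq', Finset.mem_univ,
          if_true, div_mul_eq_mul_div] at this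
        simpa using (le_div_iff₀ hR1).1 this
      rw [Set.mem_singleton_iff]
      ext j
      have h1 := hbound 1 (by simp) j
      have h2 := hbound (-1) (by simp) j
      simp only [Pi.zero_apply]
      linarith
    · have hm' : (0 : ℝ) < m := by exact_mod_cast hm
      rw [← natCast_smul_nonnegCombos_one ⟨0, h0P⟩]
      refine ⟨(m : ℝ)⁻¹ • castVec x, mem_of_forall_mem_dualBody hPc hPcl h0P ?_,
        smul_inv_smul₀ hm'.ne' _⟩
      intro u hu
      have h1 := hdual _ _ hineq u hu
      have h2 : ∑ j, u j * ((m : ℝ)⁻¹ • castVec x) j = (m : ℝ)⁻¹ * ∑ j, u j * castVec x j := by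
        rw [Finset.mul_sum]
        exact Finset.sum_congr rfl fun j _ => by rw [Pi.smul_apply, smul_eq_mul]; ring
      rw [h2, inv_mul_eq_div, le_div_iff₀ hm']
      linarith
  · rintro ⟨c, hc, hcm, hcx⟩
    obtain ⟨b, hb, hb1, hb0⟩ := zero_mem_posCombos_one h0
    refine ⟨fun i => c i + b i, fun i => add_pos_of_nonneg_of_pos (hc i) (hb i), ?_, ?_⟩
    · rw [Finset.sum_add_distrib, hcm, hb1]
    · simp only [add_smul, Finset.sum_add_distrib]
      rw [hcx, hb0, add_zero]

/-- A sequence on `ℤ` with vanishing `n`-th differences that is zero on `ℕ` is zero. -/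
lemma eq_zero_of_alternating_sum_eq_zero {n : ℕ} {e : ℤ → ℚ}
    (h : ∀ k : ℤ, ∑ j ∈ Finset.range (n + 1), (-1 : ℚ) ^ j * n.choose j * e (k - j) = 0)
    (h0 : ∀ m : ℕ, e m = 0) (m : ℤ) : e m = 0 := by
  have key : ∀ N : ℕ, ∀ m : ℤ, -(N : ℤ) ≤ m → e m = 0 := by
    intro N
    induction N with
    | zero =>
      intro m hm
      obtain ⟨k, rfl⟩ := Int.eq_ofNat_of_zero_le (by simpa using hm : 0 ≤ m)
      exact h0 k
    | succ N ih =>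
      intro m hm
      have hs := h (m + n)
      rw [Finset.sum_range_succ, Finset.sum_eq_zero, zero_add] at hs
      · simpa using hs
      · intro j hj
        have hj' := Finset.mem_range.1 hj
        rw [ih _ (by push_cast at hm; omega), mul_zero]
  exact key m.natAbs m (by omega)

lemma alternating_sum_eval_eq_zero {L : ℚ[X]} {n : ℕ} (hn : L.natDegree < n) (k : ℚ) :
    ∑ j ∈ Finset.range (n + 1), (-1 : ℚ) ^ j * n.choose j * L.eval (k - j) = 0 := by
  have hdeg : (L.comp (C k - X)).natDegree < n := by
    refine lt_of_le_of_lt natDegree_comp_le (lt_of_le_of_lt ?_ hn)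
    calc L.natDegree * (C k - X : ℚ[X]).natDegree ≤ L.natDegree * 1 := by
          refine Nat.mul_le_mul_left _ ((natDegree_sub_le _ _).trans ?_)
          simp
      _ = L.natDegree := mul_one _
  have h := congrFun (fwdDiff_iter_eq_zero_of_degree_lt hdeg) 0
  rw [fwdDiff_iter_eq_sum_shift] at h
  have h' := congrArg ((-1 : ℚ) ^ n * ·) h
  simp only [Pi.zero_apply, mul_zero, Finset.mul_sum] at h'
  rw [← h']
  refine Finset.sum_congr rfl fun j hj => ?_
  have hj' : j ≤ n := Nat.lt_succ_iff.1 (Finset.mem_range.1 hj)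
  obtain ⟨i, rfl⟩ := Nat.exists_eq_add_of_le hj'
  have hsign : (-1 : ℚ) ^ (j + i) * (-1) ^ i = (-1) ^ j := by
    rw [pow_add, mul_assoc, ← mul_pow]
    simp
  rw [← hsign]
  simp [eval_comp]
  ring

lemma natDegree_le_of_abs_eval_natCast_le {L : ℚ[X]} {A d : ℕ}
    (h : ∀ m : ℕ, |L.eval (m : ℚ)| ≤ (A * m + 1) ^ d) : L.natDegree ≤ d := by
  by_contra hcon
  set Q : ℚ[X] := (C (A : ℚ) * X + 1) ^ d with hQ
  have hQeval : ∀ m : ℕ, Q.eval (m : ℚ) = (A * m + 1) ^ d := fun m => by simp [hQ]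
  have hQ0 : Q ≠ 0 := by
    intro h0
    have := hQeval 0
    simp [h0] at this
  have hQdeg : Q.natDegree ≤ d := by
    have h1 : (C (A : ℚ) * X + 1 : ℚ[X]).natDegree ≤ 1 := by compute_degree
    exact natDegree_pow_le.trans ((Nat.mul_le_mul_left d h1).trans (mul_one d).le)
  have hdeg : Q.degree < L.degree := degree_lt_degree (lt_of_le_of_lt hQdeg (not_le.1 hcon))
  have ht := (abs_div_tendsto_atTop_atTop_of_degree_gt L Q hdeg hQ0).comp
    (tendsto_natCast_atTop_atTop (R := ℚ))
  obtain ⟨m, hm⟩ := (ht.eventually (Filter.eventually_gt_atTop 1)).exists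
  have hpos : (0 : ℚ) < (A * m + 1) ^ d := by positivity
  simp only [Function.comp_apply, hQeval, abs_div, abs_of_pos hpos] at hm
  rw [lt_div_iff₀ hpos, one_mul] at hm
  exact absurd (h m) (not_le.2 hm)

lemma coeff_nonneg_of_eval_natCast_nonneg {L : ℚ[X]} {d : ℕ} (hd : 0 < d) (hdeg : L.natDegree ≤ d)
    (h : ∀ m : ℕ, 0 ≤ L.eval (m : ℚ)) : 0 ≤ L.coeff d := by
  by_contra hcon
  have hdL : L.natDegree = d := le_antisymm hdeg (le_natDegree_of_ne_zero (ne_of_lt (not_le.1 hcon)))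
  have hlead : L.leadingCoeff ≤ 0 := by
    rw [leadingCoeff, hdL]
    exact (not_le.1 hcon).le
  have ht := (tendsto_atBot_of_leadingCoeff_nonpos L
    (natDegree_pos_iff_degree_pos.1 (by omega)) hlead).comp (tendsto_natCast_atTop_atTop (R := ℚ))
  obtain ⟨m, hm⟩ := (ht.eventually (Filter.eventually_lt_atBot 0)).exists
  exact absurd (h m) (not_le.2 hm)

/-- Ehrhart reciprocity for reflexive polytopes. -/
lemma eval_neg_one_sub_of_isReflexive {ι : Type*} [Fintype ι] [Nonempty ι] {d : ℕ}
    {v : ι → Fin d → ℤ} (href : IsReflexive d (nonnegCombos (fun i => castVec (v i)) 1))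
    {L : ℚ[X]} (hL : IsEhrhart d (nonnegCombos (fun i => castVec (v i)) 1) L)
    (hdeg : L.natDegree ≤ d) (m : ℕ) : L.eval (-1 - m : ℚ) = (-1) ^ d * L.eval (m : ℚ) := by
  set w : ι → Fin d → ℝ := fun i => castVec (v i) with hw
  have h0 := href.1
  have hcard := finrank_ker_homogenization h0
  have hLw : ∀ m : ℕ, L.eval (m : ℚ) = ((latticePts d (nonnegCombos w m)).ncard : ℚ) := by
    intro m
    rw [hL m, natCast_smul_nonnegCombos_one ⟨0, interior_subset h0⟩]
  set f : ℤ → ℚ := fun m => if 0 ≤ m then L.eval (m : ℚ) else (-1) ^ d * L.eval (-1 - m : ℚ) with hf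
  have hfcard : ∀ k : ℤ, f k = ((latticePts d (nonnegCombos w (k : ℝ))).ncard : ℚ) +
      (-1) ^ d * ((latticePts d (posCombos w ((-k : ℤ) : ℝ))).ncard : ℚ) := by
    intro k
    have hempty : latticePts d ∅ = ∅ := rfl
    by_cases hk : 0 ≤ k
    · obtain ⟨j, rfl⟩ := Int.eq_ofNat_of_zero_le hk
      rw [posCombos_of_nonpos w (by simp : ((-(j : ℤ) : ℤ) : ℝ) ≤ 0), hempty]
      simp only [hf, if_pos hk, Set.ncard_empty, Nat.cast_zero, mul_zero, add_zero]
      exact_mod_cast hLw j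
    · obtain ⟨j, rfl⟩ : ∃ j : ℕ, k = -(j + 1 : ℤ) := ⟨(-1 - k).toNat, by omega⟩
      have hneg : ((-(j + 1 : ℤ) : ℤ) : ℝ) < 0 := by
        push_cast
        linarith [(Nat.cast_nonneg j : (0 : ℝ) ≤ j)]
      rw [nonnegCombos_of_neg w hneg, hempty]
      simp only [hf, if_neg hk, Set.ncard_empty, Nat.cast_zero, zero_add]
      have h1 : (-1 - ((-(j + 1 : ℤ) : ℤ) : ℚ)) = j := by
        push_cast
        ring
      have h2 : ((-(-(j + 1 : ℤ)) : ℤ) : ℝ) = j + 1 := by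
        push_cast
        ring
      rw [h1, h2, latticePts_posCombos_eq href j, hLw]
  have hfsum : ∀ k : ℤ, ∑ j ∈ Finset.range (Fintype.card ι + 1),
      (-1 : ℚ) ^ j * (Fintype.card ι).choose j * f (k - j) = 0 := by
    intro k
    have h1 := Finset.sum_powerset_apply_card (fun j : ℕ => (-1 : ℚ) ^ j * f (k - j))
      (x := (Finset.univ : Finset ι))
    rw [Finset.powerset_univ, Finset.card_univ] at h1
    have h2 : ∑ S : Finset ι, (-1 : ℚ) ^ S.card * f (k - S.card) = 0 := by
      have h3 := congrArg (fun z : ℤ => (z : ℚ)) (sum_sign_ncard_nonnegCombos h0 k)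
      push_cast at h3
      simp only [hfcard, mul_add, Finset.sum_add_distrib, neg_sub]
      push_cast
      rw [h3, pow_succ, Finset.mul_sum, ← Finset.sum_add_distrib]
      exact Finset.sum_eq_zero fun S _ => by ring
    rw [← h2, h1]
    exact Finset.sum_congr rfl fun j _ => by rw [nsmul_eq_mul]; ring
  have hzero := eq_zero_of_alternating_sum_eq_zero (n := Fintype.card ι)
    (e := fun m => L.eval (m : ℚ) - f m) (fun k => by
      have h1 := alternating_sum_eval_eq_zero (L := L) (n := Fintype.card ι) (by omega) (k : ℚ)
      have h2 := hfsum k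
      simp only [mul_sub, Finset.sum_sub_distrib]
      push_cast
      rw [h1, h2, sub_zero])
    (fun m => by simp [hf]) (-1 - m)
  have hneg : ¬ (0 : ℤ) ≤ -1 - m := by omega
  simp only [hf, if_neg hneg] at hzero
  push_cast at hzero
  rw [sub_sub_cancel, sub_eq_zero] at hzero
  exact hzero

/-- The coefficients of an even quartic in terms of a root that is neither real nor imaginary. -/
lemma even_quartic_coeff_eq {N E F a b : ℝ} (ha : a ≠ 0) (hb : b ≠ 0)
    (hroot : (N : ℂ) * (a + b * Complex.I) ^ 4 + E * (a + b * Complex.I) ^ 2 + F = 0) :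
    E = -2 * N * (a ^ 2 - b ^ 2) ∧ F = N * (a ^ 2 + b ^ 2) ^ 2 := by
  have hsq : ((a : ℂ) + b * Complex.I) ^ 2 = ((a ^ 2 - b ^ 2 : ℝ) : ℂ) +
      ((2 * a * b : ℝ) : ℂ) * Complex.I := by
    push_cast
    linear_combination (b : ℂ) ^ 2 * Complex.I_sq
  have hexp : (((N * ((a ^ 2 - b ^ 2) ^ 2 - (2 * a * b) ^ 2) + E * (a ^ 2 - b ^ 2) + F : ℝ)) : ℂ) +
      ((2 * a * b * (2 * N * (a ^ 2 - b ^ 2) + E) : ℝ) : ℂ) * Complex.I = 0 := by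
    rw [← hroot, show 4 = 2 * 2 from rfl, pow_mul, hsq]
    push_cast
    linear_combination -(N : ℂ) * (2 * a * b) ^ 2 * Complex.I_sq
  have hre := congrArg Complex.re hexp
  have him := congrArg Complex.im hexp
  simp only [Complex.add_re, Complex.add_im, Complex.ofReal_re, Complex.ofReal_im,
    Complex.re_ofReal_mul, Complex.im_ofReal_mul, Complex.I_re, Complex.I_im, mul_zero, mul_one,
    add_zero, zero_add, Complex.zero_re, Complex.zero_im] at hre him
  have hE : E = -2 * N * (a ^ 2 - b ^ 2) := by
    rcases mul_eq_zero.1 him with h | h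
    · exact absurd h (mul_ne_zero (mul_ne_zero two_ne_zero ha) hb)
    · linarith
  refine ⟨hE, ?_⟩
  rw [hE] at hre
  linarith

/-- The roots of the even quartic with root `a + b * I` are `± a ± b * I`. -/
lemma abs_re_eq_of_even_quartic_root {N a b : ℝ} (hN : N ≠ 0) {z : ℂ}
    (hz : (N : ℂ) * z ^ 4 + ((-2 * N * (a ^ 2 - b ^ 2) : ℝ) : ℂ) * z ^ 2 +
      ((N * (a ^ 2 + b ^ 2) ^ 2 : ℝ) : ℂ) = 0) : |z.re| = |a| := by
  have hfac : (N : ℂ) * ((z - (a + b * Complex.I)) * (z + (a + b * Complex.I)) *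
      ((z - (a - b * Complex.I)) * (z + (a - b * Complex.I)))) = 0 := by
    rw [← hz]
    push_cast
    ring_nf
    rw [show Complex.I ^ 4 = (Complex.I ^ 2) ^ 2 by ring, Complex.I_sq]
    ring
  have hcase : ∀ x : ℂ, |x.re| = |a| → (z - x = 0 ∨ z + x = 0) → |z.re| = |a| := by
    rintro x hx (h | h)
    · rw [sub_eq_zero.1 h, hx]
    · rw [eq_neg_of_add_eq_zero_left h, Complex.neg_re, abs_neg, hx]
  rcases mul_eq_zero.1 ((mul_eq_zero.1 hfac).resolve_left (by exact_mod_cast hN)) with h | h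
  · exact hcase (a + b * Complex.I) (by simp) (mul_eq_zero.1 h)
  · exact hcase (a - b * Complex.I) (by simp) (mul_eq_zero.1 h)

lemma sq_lt_of_quartic_coeff_bounds {N c a b : ℝ} (hN : 0 ≤ N) (hc : 2 ≤ N + c)
    (hE : c - 3 / 2 * N = -2 * N * (a ^ 2 - b ^ 2))
    (hF : 1 + 5 / 16 * N - c / 4 = N * (a ^ 2 + b ^ 2) ^ 2) : N ≠ 0 ∧ a ^ 2 < (3 / 2) ^ 2 := by
  have hN0 : N ≠ 0 := by
    rintro rfl
    simp at hE
    linarith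
  have hNpos : 0 < N := lt_of_le_of_ne hN hN0.symm
  refine ⟨hN0, ?_⟩
  by_contra hcon
  have ha : 9 / 4 ≤ a ^ 2 := by
    have := not_lt.1 hcon
    linarith
  have h1 : 13 / 4 * N + 1 ≤ N * (a ^ 2 + b ^ 2) := by
    have := mul_le_mul_of_nonneg_left ha hN
    linarith
  have h2 : (13 / 4 * N + 1) ^ 2 ≤ (N * (a ^ 2 + b ^ 2)) ^ 2 :=
    pow_le_pow_left₀ (by positivity) h1 2
  have h3 : (N * (a ^ 2 + b ^ 2)) ^ 2 = N * (1 + 5 / 16 * N - c / 4) := by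
    rw [hF]
    ring
  have h4 : N * (1 + 5 / 16 * N - c / 4) ≤ N * (1 / 2 + 9 / 16 * N) :=
    mul_le_mul_of_nonneg_left (by linarith) hN
  nlinarith [mul_pos hNpos hNpos]

lemma card_le_ncard_latticePts {ι : Type*} [Fintype ι] {d : ℕ} {v : ι → Fin d → ℤ}
    (hv : Function.Injective v) :
    Fintype.card ι ≤ (latticePts d (nonnegCombos (fun i => castVec (v i)) 1)).ncard := by
  rw [← Nat.card_eq_fintype_card, ← Set.ncard_univ, ← Set.ncard_image_of_injective _ hv]
  refine Set.ncard_le_ncard ?_ (finite_latticePts_nonnegCombos v 1)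
  rintro _ ⟨i, -, rfl⟩
  have h : castVec (v i) ∈ convexHull ℝ (Set.range fun i => castVec (v i)) :=
    subset_convexHull ℝ _ ⟨i, rfl⟩
  rwa [convexHull_range_eq_nonnegCombos] at h

lemma exists_eq_nonnegCombos_of_isLatticePolytope {d : ℕ} {P : Set (Fin d → ℝ)}
    (hP : IsLatticePolytope d P) (hne : P.Nonempty) :
    ∃ V : Finset (Fin d → ℤ), Nonempty V ∧
      P = nonnegCombos (fun i : V => castVec (i : Fin d → ℤ)) 1 := by
  obtain ⟨V, hV⟩ := hP
  refine ⟨V, ?_, ?_⟩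
  · rw [hV, convexHull_nonempty_iff, Set.image_nonempty] at hne
    exact hne.to_subtype
  · rw [hV, ← convexHull_range_eq_nonnegCombos]
    congr 1
    ext x
    simp only [Set.mem_image, Finset.mem_coe, Set.mem_range, Subtype.exists, exists_prop]
    rfl

/-- The Ehrhart polynomial of a four-dimensional reflexive polytope is a quadratic polynomial
in `X ^ 2 + X`. -/
lemma exists_ehrhart_coeffs_of_isReflexive {P : Set (Fin 4 → ℝ)} {L : ℚ[X]}
    (hP : IsLatticePolytope 4 P) (href : IsReflexive 4 P) (hL : IsEhrhart 4 P L) :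
    ∃ N c : ℚ, 0 ≤ N ∧ 2 ≤ N + c ∧ L = C N * (X ^ 2 + X) ^ 2 + C (c - N) * (X ^ 2 + X) + 1 := by
  have hne : P.Nonempty := ⟨0, interior_subset href.1⟩
  obtain ⟨V, hVne, rfl⟩ := exists_eq_nonnegCombos_of_isLatticePolytope hP hne
  have hLm : ∀ m : ℕ, L.eval (m : ℚ) =
      ((latticePts 4 (nonnegCombos (fun i : V => castVec (i : Fin 4 → ℤ)) m)).ncard : ℚ) := by
    intro m
    rw [hL m, natCast_smul_nonnegCombos_one hne]
  obtain ⟨R, hR⟩ := exists_abs_castVec_le (fun i : V => (i : Fin 4 → ℤ))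
  have hnonneg : ∀ m : ℕ, 0 ≤ L.eval (m : ℚ) := fun m => by
    rw [hLm]
    positivity
  have hdeg : L.natDegree ≤ 4 := by
    refine natDegree_le_of_abs_eval_natCast_le (A := 2 * R) fun m => ?_
    rw [abs_of_nonneg (hnonneg m), hLm]
    exact_mod_cast ncard_latticePts_nonnegCombos_le hR m
  have hzero : L.eval 0 = 1 := by
    have h := hLm 0
    have hpts : latticePts 4 {0} = {0} := by
      ext x
      simp [latticePts, funext_iff]
    rw [Nat.cast_zero, Nat.cast_zero, nonnegCombos_zero, hpts, Set.ncard_singleton] at h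
    exact_mod_cast h
  have hone : 5 ≤ L.eval 1 := by
    have h := hLm 1
    rw [Nat.cast_one, Nat.cast_one] at h
    rw [h]
    have hcard := finrank_ker_homogenization href.1
    have hle := card_le_ncard_latticePts (Subtype.val_injective (p := fun x => x ∈ V))
    exact_mod_cast (show 5 ≤ Fintype.card V by omega).trans hle
  have hrec0 := eval_neg_one_sub_of_isReflexive href hL hdeg 0
  have hrec1 := eval_neg_one_sub_of_isReflexive href hL hdeg 1
  have hexp : ∀ x : ℚ, L.eval x = L.coeff 0 + L.coeff 1 * x + L.coeff 2 * x ^ 2 +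
      L.coeff 3 * x ^ 3 + L.coeff 4 * x ^ 4 := by
    intro x
    rw [eval_eq_sum_range' (Nat.lt_succ_of_le hdeg)]
    simp [Finset.sum_range_succ]
  simp only [hexp] at hzero hone hrec0 hrec1
  norm_num at hzero hone hrec0 hrec1
  have h3 : L.coeff 3 = 2 * L.coeff 4 := by linarith
  have h1 : L.coeff 1 = L.coeff 2 - L.coeff 4 := by linarith
  refine ⟨L.coeff 4, L.coeff 2, coeff_nonneg_of_eval_natCast_nonneg (by norm_num) hdeg hnonneg,
    by linarith, Polynomial.funext fun x => ?_⟩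
  rw [hexp, hzero, h1, h3]
  simp
  ring

theorem statement10 (P : Set (Fin 4 → ℝ)) (L : Polynomial ℚ) (a b : ℝ)
    (hP : IsLatticePolytope 4 P) (hdim : IsFullDim 4 P) (href : IsReflexive 4 P)
    (hL : IsEhrhart 4 P L) (ha : a ≠ 0) (hb : b ≠ 0)
    (hroot : ((-(1/2) + a : ℝ) : ℂ) + b * Complex.I ∈ cRoots L) :
    |a| < 3/2 ∧ ∀ z ∈ cRoots L, -2 ≤ z.re ∧ z.re ≤ 1 := by
  obtain ⟨N, c, hN, hc, hLeq⟩ := exists_ehrhart_coeffs_of_isReflexive hP href hL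
  have hquartic : ∀ z ∈ cRoots L, ((N : ℝ) : ℂ) * (z + 1 / 2) ^ 4 +
      ((c - 3 / 2 * N : ℝ) : ℂ) * (z + 1 / 2) ^ 2 + ((1 + 5 / 16 * N - c / 4 : ℝ) : ℂ) = 0 := by
    intro z hz
    have hz0 := (mem_roots'.1 hz).2
    rw [IsRoot.def, hLeq] at hz0
    simp at hz0
    push_cast
    linear_combination hz0
  have hab := hquartic _ hroot
  rw [show ((-(1/2) + a : ℝ) : ℂ) + b * Complex.I + 1 / 2 = a + b * Complex.I by
    push_cast
    ring] at hab
  obtain ⟨hE, hF⟩ := even_quartic_coeff_eq ha hb hab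
  obtain ⟨hN0, hsq⟩ := sq_lt_of_quartic_coeff_bounds (by exact_mod_cast hN) (by exact_mod_cast hc)
    hE hF
  have hlt : |a| < 3 / 2 := abs_lt_of_sq_lt_sq hsq (by norm_num)
  refine ⟨hlt, fun z hz => ?_⟩
  have hz0 := hquartic z hz
  rw [hE, hF] at hz0
  have hre := abs_re_eq_of_even_quartic_root hN0 hz0
  rw [← hre, abs_lt] at hlt
  simp at hlt
  constructor <;> linarith
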